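/- Let w be a word with w ∉ Mon, and let x be a single letter such that either x ∈ S' or x ∉ Mon. Assume all maximal occurrences in w have Λ'-measure ≤ μ. Then all maximal occurrences in the reduced products x·w and w·x have Λ'-measure ≤ μ + 1. Moreover, if the product x·w has no cancellation, then the word xw ∉ Mon, and if the product w·x has no cancellation, then the word wx ∉ Mon. -/

import Mathlib

/-- A *word*: a list of letters, where a letter is a free generator of the free group `F`
together with a sign (`true` for the generator, `false` for its inverse). -/
abbrev Word (α : Type*) := List (α × Bool)

/-- A word is *reduced* if no two adjacent letters cancel. -/
def Reduced {α : Type*} (w : Word α) : Prop :=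
  w.Chain' fun a b => ¬(a.1 = b.1 ∧ a.2 = !b.2)

/-- A word is *cyclically reduced* if it is reduced and its last letter is not the inverse of
its first letter; equivalently, `w ++ w` is reduced. -/
def CyclicallyReduced {α : Type*} (w : Word α) : Prop := Reduced (w ++ w)

/-- A set of words is closed under taking subwords. -/
def SubwordClosed {α : Type*} (M : Set (Word α)) : Prop :=
  ∀ w ∈ M, ∀ u : Word α, u <:+: w → u ∈ M

/-- `Occurs u A i` : the word `u` occurs in the word `A` starting at position `i`.
An *occurrence* of `u` in `A` is such a pair `(i, u)`. -/
def Occurs {α : Type*} (u A : Word α) (i : ℕ) : Prop :=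
  ∃ L R : Word α, A = L ++ u ++ R ∧ L.length = i

/-- The occurrence of `u` at position `i` is contained in the occurrence of `v` at position `j`. -/
def OccContained {α : Type*} (i : ℕ) (u : Word α) (j : ℕ) (v : Word α) : Prop :=
  j ≤ i ∧ i + u.length ≤ j + v.length

/-- `IsMaxOcc M A i u` : `(i, u)` is a *maximal occurrence* in `A` with respect to `M`:
an occurrence of an element of `M` in `A` that is not properly contained in any other
occurrence of an element of `M` in `A`. -/
def IsMaxOcc {α : Type*} (M : Set (Word α)) (A : Word α) (i : ℕ) (u : Word α) : Prop :=
  u ∈ M ∧ Occurs u A i ∧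
    ∀ j v, v ∈ M → Occurs v A j → OccContained i u j v → i = j ∧ u = v

/-- `LambdaLe S' u m` says that the `Λ'`-measure of `u` with respect to the set of small
pieces `S'` is at most `m`: `u` is a concatenation of at most `m` elements of `S'`.
Thus `¬ LambdaLe S' u m` says `Λ'(u) > m` (including the case `Λ'(u) = ∞`). -/
def LambdaLe {α : Type*} (S' : Set (Word α)) (u : Word α) (m : ℕ) : Prop :=
  ∃ parts : List (Word α), (∀ p ∈ parts, p ∈ S') ∧ parts.flatten = u ∧ parts.length ≤ m

theorem Occurs.isInfix_of_contained {α : Type*} {u v A : Word α} {i j : ℕ}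
    (hu : Occurs u A i) (hv : Occurs v A j) (h : OccContained i u j v) : u <:+: v := by
  obtain ⟨L, R, rfl, rfl⟩ := hu
  obtain ⟨L', R', hA, rfl⟩ := hv
  obtain ⟨h1, h2⟩ := h
  rw [List.append_assoc, List.append_assoc] at hA
  obtain ⟨K, rfl⟩ := List.prefix_of_prefix_length_le ⟨v ++ R', rfl⟩ ⟨u ++ R, hA⟩ h1
  rw [List.append_assoc, List.append_cancel_left_eq, ← List.append_assoc] at hA
  have hp : K ++ u <+: v := by
    refine List.prefix_of_prefix_length_le ⟨R, hA⟩ ⟨R', rfl⟩ ?_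
    simp only [List.length_append] at h2 ⊢
    omega
  exact (List.suffix_append K u).isInfix.trans hp.isInfix

theorem Occurs.of_isInfix {α : Type*} {u A : Word α} (h : u <:+: A) : ∃ i, Occurs u A i := by
  obtain ⟨L, R, h⟩ := h
  exact ⟨_, L, R, h.symm, rfl⟩

theorem Occurs.isInfix {α : Type*} {u A : Word α} {i : ℕ} (h : Occurs u A i) : u <:+: A := by
  obtain ⟨L, R, h, -⟩ := h
  exact ⟨L, R, h.symm⟩

/-- Every occurrence of an element of `M` lies in a maximal occurrence. -/
theorem Occurs.exists_isMaxOcc {α : Type*} {M : Set (Word α)} {A u : Word α} {i : ℕ}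
    (hu : u ∈ M) (hi : Occurs u A i) : ∃ j v, IsMaxOcc M A j v ∧ u <:+: v := by
  induction hn : A.length - u.length using Nat.strong_induction_on generalizing u i with
  | _ n ih =>
    by_cases hmax : IsMaxOcc M A i u
    · exact ⟨i, u, hmax, List.infix_rfl⟩
    · have : ∃ j v, v ∈ M ∧ Occurs v A j ∧ OccContained i u j v ∧ ¬(i = j ∧ u = v) := by
        by_contra! hne
        exact hmax ⟨hu, hi, fun j v hv hj hc => hne j v hv hj hc⟩
      obtain ⟨j, v, hv, hj, hc, hne⟩ := this
      have huv := hi.isInfix_of_contained hj hc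
      have hlt : u.length < v.length := by
        refine lt_of_le_of_ne huv.length_le fun he => hne ⟨?_, huv.eq_of_length he⟩
        obtain ⟨h1, h2⟩ := hc
        omega
      have hle := hj.isInfix.length_le
      obtain ⟨k, z, hz, hvz⟩ := ih (A.length - v.length) (by omega) hv hj rfl
      exact ⟨k, z, hz, huv.trans hvz⟩

theorem LambdaLe.cons {α : Type*} {S : Set (Word α)} {p u : Word α} {m : ℕ} (hp : p ∈ S)
    (hu : LambdaLe S u m) : LambdaLe S (p ++ u) (m + 1) := by
  obtain ⟨ps, h1, rfl, h3⟩ := hu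
  exact ⟨p :: ps, by simpa [hp] using h1, rfl, by simpa using h3⟩

theorem LambdaLe.concat {α : Type*} {S : Set (Word α)} {p u : Word α} {m : ℕ} (hp : p ∈ S)
    (hu : LambdaLe S u m) : LambdaLe S (u ++ p) (m + 1) := by
  obtain ⟨ps, h1, rfl, h3⟩ := hu
  refine ⟨ps ++ [p], ?_, by simp, by simpa using h3⟩
  intro q hq
  rcases List.mem_append.1 hq with hq | hq
  · exact h1 q hq
  · rwa [List.mem_singleton.1 hq]

theorem LambdaLe.mono {α : Type*} {S : Set (Word α)} {u : Word α} {m n : ℕ}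
    (hu : LambdaLe S u m) (h : m ≤ n) : LambdaLe S u n := by
  obtain ⟨ps, h1, h2, h3⟩ := hu
  exact ⟨ps, h1, h2, h3.trans h⟩

theorem LambdaLe.nil {α : Type*} {S : Set (Word α)} {m : ℕ} : LambdaLe S [] m :=
  ⟨[], by simp, rfl, Nat.zero_le _⟩

theorem LambdaLe.of_isInfix {α : Type*} {S : Set (Word α)} (hS : SubwordClosed S)
    {u v : Word α} {m : ℕ} (hv : LambdaLe S v m) (huv : u <:+: v) : LambdaLe S u m := by
  obtain ⟨ps, h1, rfl, h3⟩ := hv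
  refine LambdaLe.mono ?_ h3
  clear h3
  induction ps generalizing u with
  | nil =>
    rw [List.flatten_nil, List.infix_nil] at huv
    exact huv ▸ LambdaLe.nil
  | cons p ps ih =>
    have hp : p ∈ S := h1 p (by simp)
    replace ih := fun {u} => @ih u fun q hq => h1 q (List.mem_cons_of_mem _ hq)
    rw [List.flatten_cons, List.infix_append_iff] at huv
    rcases huv with h | h | ⟨s, t, rfl, hs, ht⟩
    · simpa using (LambdaLe.nil (m := ps.length)).cons (hS p hp u h)
    · exact (ih h).mono (Nat.le_succ _)
    · exact (ih ht.isInfix).cons (hS p hp s hs.isInfix)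

theorem Reduced.reduce_eq {α : Type*} [DecidableEq α] {w : Word α} (hw : Reduced w) :
    FreeGroup.reduce w = w := by
  refine FreeGroup.IsReduced.reduce_eq (hw.imp fun a b h hab => ?_)
  cases ha : a.2 <;> cases hb : b.2 <;> simp_all

/-- The reduced product of a letter and a reduced word is their concatenation or, after
cancellation, a subword of the given word. -/
theorem Reduced.reduce_cons {α : Type*} [DecidableEq α] {w : Word α} (hw : Reduced w)
    (x : α × Bool) :
    FreeGroup.reduce (x :: w) = x :: w ∨ FreeGroup.reduce (x :: w) <:+: w := by
  rw [FreeGroup.reduce.cons, hw.reduce_eq]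
  cases w with
  | nil => exact Or.inl rfl
  | cons y w =>
    dsimp only
    split_ifs
    · exact Or.inr (List.suffix_cons y w).isInfix
    · exact Or.inl rfl

/-- The reduced product of a reduced word and a letter is their concatenation or, after
cancellation, a subword of the given word. -/
theorem Reduced.reduce_concat {α : Type*} [DecidableEq α] {w : Word α} (hw : Reduced w)
    (x : α × Bool) :
    FreeGroup.reduce (w ++ [x]) = w ++ [x] ∨ FreeGroup.reduce (w ++ [x]) <:+: w := by
  rcases List.eq_nil_or_concat' w with rfl | ⟨r, y, rfl⟩
  · exact Or.inl rfl
  · by_cases h : y.1 = x.1 ∧ y.2 = !x.2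
    · right
      have hr : Reduced r := List.IsChain.left_of_append hw
      have hstep : FreeGroup.Red.Step (r ++ [y] ++ [x]) r := by
        obtain ⟨a, b⟩ := x
        obtain ⟨c, d⟩ := y
        dsimp only at h
        obtain ⟨rfl, rfl⟩ := h
        simpa using FreeGroup.Red.Step.not_rev (L₁ := r) (L₂ := []) (x := c) (b := b)
      rw [FreeGroup.reduce.Step.eq hstep, hr.reduce_eq]
      exact (List.prefix_append r [y]).isInfix
    · left
      refine Reduced.reduce_eq (List.IsChain.append hw (List.isChain_singleton x) ?_)
      simpa using h

theorem LambdaLe.of_mem_of_isInfix {α : Type*} {M S : Set (Word α)} {m : ℕ} {w u : Word α}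
    (hS : SubwordClosed S) (hm : ∀ i u, IsMaxOcc M w i u → LambdaLe S u m)
    (hu : u ∈ M) (huw : u <:+: w) : LambdaLe S u m := by
  obtain ⟨i, hi⟩ := Occurs.of_isInfix huw
  obtain ⟨j, v, hv, huv⟩ := hi.exists_isMaxOcc hu
  exact (hm j v hv).of_isInfix hS huv


/-- Let `w ∉ Mon` be a (reduced) word and `x` a single letter with `[x] ∈ S'`
or `[x] ∉ Mon`. If all maximal occurrences in `w` have `Λ'`-measure `≤ μ`, then all maximal
occurrences in the reduced products `x·w` and `w·x` have `Λ'`-measure `≤ μ + 1`. Moreover,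
if the product `x·w` has no cancellation then `xw ∉ Mon`, and if the product `w·x` has no
cancellation then `wx ∉ Mon`. -/
theorem small_increasing {α : Type*} [DecidableEq α] (Mon S' : Set (Word α)) (μ : ℕ)
    (hMon : SubwordClosed Mon)
    (hS'empty : ([] : Word α) ∈ S') (hS'sub : SubwordClosed S')
    (w : Word α) (hw : Reduced w) (hwM : w ∉ Mon)
    (x : α × Bool) (hx : [x] ∈ S' ∨ [x] ∉ Mon)
    (hμ : ∀ i u, IsMaxOcc Mon w i u → LambdaLe S' u μ) :
    (∀ i u, IsMaxOcc Mon (FreeGroup.reduce (x :: w)) i u → LambdaLe S' u (μ + 1)) ∧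
    (∀ i u, IsMaxOcc Mon (FreeGroup.reduce (w ++ [x])) i u → LambdaLe S' u (μ + 1)) ∧
    (Reduced (x :: w) → (x :: w) ∉ Mon) ∧
    (Reduced (w ++ [x]) → (w ++ [x]) ∉ Mon) := by
  have key : ∀ u ∈ Mon, u <:+: w → LambdaLe S' u μ := fun u hu huw =>
    LambdaLe.of_mem_of_isInfix hS'sub hμ hu huw
  have hxS : ∀ u ∈ Mon, [x] <:+: u → [x] ∈ S' := fun u hu h =>
    hx.resolve_right (not_not.2 (hMon u hu _ h))
  refine ⟨?_, ?_, fun _ h => hwM (hMon _ h w (List.suffix_cons x w).isInfix),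
    fun _ h => hwM (hMon _ h w (List.prefix_append w [x]).isInfix)⟩
  · rintro i u ⟨hu, hocc, -⟩
    rcases hw.reduce_cons x with h | h
    · have hi := hocc.isInfix
      rw [h, List.infix_cons_iff, List.prefix_cons_iff] at hi
      rcases hi with (rfl | ⟨t, rfl, ht⟩) | hi
      · exact LambdaLe.nil
      · exact (key t (hMon _ hu t (List.suffix_cons x t).isInfix) ht.isInfix).cons
          (hxS _ hu ⟨[], t, rfl⟩)
      · exact (key u hu hi).mono (Nat.le_succ μ)
    · exact (key u hu (hocc.isInfix.trans h)).mono (Nat.le_succ μ)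
  · rintro i u ⟨hu, hocc, -⟩
    rcases hw.reduce_concat x with h | h
    · have hi := hocc.isInfix
      rw [h, List.infix_concat_iff, List.suffix_concat_iff] at hi
      rcases hi with (rfl | ⟨t, rfl, ht⟩) | hi
      · exact LambdaLe.nil
      · exact (key t (hMon _ hu t (List.prefix_append t [x]).isInfix) ht.isInfix).concat
          (hxS _ hu ⟨t, [], by simp⟩)
      · exact (key u hu hi).mono (Nat.le_succ μ)
    · exact (key u hu (hocc.isInfix.trans h)).mono (Nat.le_succ μ)
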